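/- For every n ≥ 1 and k ≥ 0, the center map D_n(k) → C⁰_k(B(0,1)) sending ((a_1,r_1),…,(a_k,r_k)) to (a_1,…,a_k), with target the ordered configuration space of the open unit ball B(0,1) ⊆ ℝ^n, is a Σ_k-equivariant homotopy equivalence: there exist a Σ_k-equivariant homotopy inverse and Σ_k-equivariant homotopies exhibiting both composites as homotopic to the identity maps. -/

import Mathlib

open scoped unitInterval Topology
open Metric Set

noncomputable section

/-! ### Ordered configuration spaces -/

/-- The ordered configuration space `C⁰_k(M)`: `k`-tuples of pairwise distinct points of `M`,
topologized as a subspace of `M^k`. -/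
def OrdConfig (M : Type*) [TopologicalSpace M] (k : ℕ) : Type _ :=
  {p : Fin k → M // Function.Injective p}

instance (M : Type*) [TopologicalSpace M] (k : ℕ) : TopologicalSpace (OrdConfig M k) :=
  inferInstanceAs (TopologicalSpace {p : Fin k → M // Function.Injective p})

/-- The action of the symmetric group `Σ_k` on the ordered configuration space,
permuting the coordinates. -/
def OrdConfig.perm {M : Type*} [TopologicalSpace M] {k : ℕ} (e : Equiv.Perm (Fin k))
    (p : OrdConfig M k) : OrdConfig M k :=
  ⟨p.1 ∘ e, p.2.comp e.injective⟩

/-- The space of little `n`-discs `D_n(k)`: `k`-tuples `((a_1,r_1),…,(a_k,r_k))` with each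
`r_i > 0`, each closed ball `B̄(a_i,r_i)` contained in the closed unit ball, and the open balls
`B(a_i,r_i)` pairwise disjoint; topologized as a subspace of `(ℝ^n × ℝ)^k`. -/
def LittleDiscs (n k : ℕ) : Type :=
  {d : Fin k → EuclideanSpace ℝ (Fin n) × ℝ //
    (∀ i, 0 < (d i).2 ∧
        Metric.closedBall (d i).1 (d i).2 ⊆ Metric.closedBall (0 : EuclideanSpace ℝ (Fin n)) 1) ∧
      Pairwise fun i j => Disjoint (Metric.ball (d i).1 (d i).2) (Metric.ball (d j).1 (d j).2)}

instance (n k : ℕ) : TopologicalSpace (LittleDiscs n k) :=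
  inferInstanceAs (TopologicalSpace {_d : Fin k → EuclideanSpace ℝ (Fin n) × ℝ // _})

/-- The action of the symmetric group `Σ_k` on `D_n(k)`, permuting the `k` little discs. -/
def LittleDiscs.perm {n k : ℕ} (e : Equiv.Perm (Fin k)) (d : LittleDiscs n k) :
    LittleDiscs n k :=
  ⟨d.1 ∘ e, fun i => d.2.1 (e i), fun _ _ hij => d.2.2 (e.injective.ne hij)⟩

/-- The open unit ball in `ℝ^n`. -/
def UnitBall (n : ℕ) : Type :=
  ↥(Metric.ball (0 : EuclideanSpace ℝ (Fin n)) 1)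

instance (n : ℕ) : TopologicalSpace (UnitBall n) :=
  inferInstanceAs (TopologicalSpace ↥(Metric.ball (0 : EuclideanSpace ℝ (Fin n)) 1))

/-- The center of a little disc lies in the open unit ball. -/
lemma center_mem_unitBall {n : ℕ} {a : EuclideanSpace ℝ (Fin n)} {r : ℝ} (hr : 0 < r)
    (h : Metric.closedBall a r ⊆ Metric.closedBall (0 : EuclideanSpace ℝ (Fin n)) 1) :
    a ∈ Metric.ball (0 : EuclideanSpace ℝ (Fin n)) 1 := by
  rcases eq_or_ne a 0 with rfl | ha
  · exact Metric.mem_ball_self one_pos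
  · have hna : 0 < ‖a‖ := norm_pos_iff.mpr ha
    have hp : a + (r / ‖a‖) • a ∈ Metric.closedBall a r := by
      rw [Metric.mem_closedBall, dist_eq_norm, add_sub_cancel_left, norm_smul,
        Real.norm_eq_abs, abs_of_pos (by positivity), div_mul_cancel₀ _ hna.ne']
    have key : ‖a + (r / ‖a‖) • a‖ ≤ 1 := by
      have := h hp
      rwa [Metric.mem_closedBall, dist_zero_right] at this
    have hnorm : ‖a + (r / ‖a‖) • a‖ = ‖a‖ + r := by
      have heq : a + (r / ‖a‖) • a = (1 + r / ‖a‖) • a := by rw [add_smul, one_smul]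
      rw [heq, norm_smul, Real.norm_eq_abs, abs_of_pos (by positivity)]
      field_simp
    rw [mem_ball_zero_iff]
    rw [hnorm] at key
    linarith

/-- The center map `D_n(k) → C⁰_k(B(0,1))` recording the centers of the little discs. -/
def centerMap (n k : ℕ) : C(LittleDiscs n k, OrdConfig (UnitBall n) k) :=
  ⟨fun d => ⟨fun i => ⟨(d.1 i).1, center_mem_unitBall (d.2.1 i).1 (d.2.1 i).2⟩,
    fun i j hij => by
      by_contra hne
      have hc : (d.1 i).1 = (d.1 j).1 := congrArg Subtype.val hij
      have h2 : (d.1 i).1 ∈ Metric.ball (d.1 j).1 (d.1 j).2 := by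
        rw [hc]; exact Metric.mem_ball_self (d.2.1 j).1
      exact Set.disjoint_left.mp (d.2.2 hne) (Metric.mem_ball_self (d.2.1 i).1) h2⟩, by
    apply Continuous.subtype_mk
    exact continuous_pi fun i => Continuous.subtype_mk
      (continuous_fst.comp ((continuous_apply i).comp continuous_subtype_val)) _⟩

/-- A radius bound for a ball inside the closed unit ball of a nontrivial normed space. -/
lemma add_norm_le_one_of_closedBall_subset {E : Type*} [NormedAddCommGroup E] [NormedSpace ℝ E]
    [Nontrivial E] {a : E} {r : ℝ} (hr : 0 ≤ r) (h : closedBall a r ⊆ closedBall (0 : E) 1) :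
    r + ‖a‖ ≤ 1 := by
  obtain ⟨u, hu, hau⟩ : ∃ u : E, ‖u‖ = 1 ∧ a = ‖a‖ • u := by
    rcases eq_or_ne a 0 with rfl | ha
    · obtain ⟨u, hu⟩ := exists_norm_eq E zero_le_one
      exact ⟨u, hu, by simp⟩
    · exact ⟨‖a‖⁻¹ • a, norm_smul_inv_norm ha, by
        rw [smul_inv_smul₀ (norm_ne_zero_iff.mpr ha)]⟩
  have hmem : a + r • u ∈ closedBall a r := by
    simp [mem_closedBall, dist_eq_norm, norm_smul, hu, abs_of_nonneg hr]
  have hle : ‖a + r • u‖ ≤ 1 := by simpa using h hmem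
  have heq : a + r • u = (r + ‖a‖) • u := by
    rw [add_smul, ← hau, add_comm]
  rwa [heq, norm_smul, hu, mul_one, Real.norm_of_nonneg (by positivity)] at hle

/-- The minimum of the distance from `x i` to the unit sphere and half the distances from `x i` to
the other points of `x`. -/
def clearance {E ι : Type*} [NormedAddCommGroup E] [DecidableEq ι] (x : ι → E) (i : ι) : ℝ :=
  ⨅ j, if i = j then 1 - ‖x i‖ else dist (x i) (x j) / 2

section Clearance

variable {E ι : Type*} [NormedAddCommGroup E] [DecidableEq ι]

lemma clearance_comp_perm (x : ι → E) (e : Equiv.Perm ι) (i : ι) :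
    clearance (x ∘ e) i = clearance x (e i) := by
  simpa [clearance] using
    e.iInf_comp (g := fun j => if e i = j then 1 - ‖x (e i)‖ else dist (x (e i)) (x j) / 2)

variable [Finite ι]

lemma clearance_add_norm_le_one (x : ι → E) (i : ι) : clearance x i + ‖x i‖ ≤ 1 := by
  have h := ciInf_le (Set.finite_range
    fun j => if i = j then 1 - ‖x i‖ else dist (x i) (x j) / 2).bddBelow i
  rw [if_pos rfl] at h
  exact le_sub_iff_add_le.mp h

lemma clearance_le_half_dist (x : ι → E) {i j : ι} (hij : i ≠ j) :
    clearance x i ≤ dist (x i) (x j) / 2 := by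
  have h := ciInf_le (Set.finite_range
    fun j => if i = j then 1 - ‖x i‖ else dist (x i) (x j) / 2).bddBelow j
  rwa [if_neg hij] at h

lemma clearance_add_clearance_le (x : ι → E) {i j : ι} (hij : i ≠ j) :
    clearance x i + clearance x j ≤ dist (x i) (x j) := by
  have h₁ := clearance_le_half_dist x hij
  have h₂ := clearance_le_half_dist x hij.symm
  rw [dist_comm] at h₂
  linarith

lemma clearance_pos {x : ι → E} (hx : Function.Injective x) {i : ι} (hi : ‖x i‖ < 1) :
    0 < clearance x i := by
  have : Nonempty ι := ⟨i⟩
  obtain ⟨j, hj⟩ := exists_eq_ciInf_of_finite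
    (f := fun j => if i = j then 1 - ‖x i‖ else dist (x i) (x j) / 2)
  rw [clearance, ← hj]
  split_ifs with hij
  · linarith
  · exact half_pos (dist_pos.mpr (hx.ne hij))

@[fun_prop]
lemma continuous_clearance (i : ι) : Continuous fun x : ι → E => clearance x i := by
  have := Fintype.ofFinite ι
  have : Nonempty ι := ⟨i⟩
  simp only [clearance, ← Finset.inf'_univ_eq_ciInf]
  refine Continuous.finset_inf'_apply _ fun j _ => ?_
  split_ifs <;> fun_prop

end Clearance

namespace LittleDiscs

variable {n k : ℕ}

/-- A tuple of little discs, given by centers and radii satisfying the separation inequalities. -/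
def ofRadii (a : Fin k → EuclideanSpace ℝ (Fin n)) (r : Fin k → ℝ) (hpos : ∀ i, 0 < r i)
    (hone : ∀ i, r i + ‖a i‖ ≤ 1) (hsep : ∀ i j, i ≠ j → r i + r j ≤ dist (a i) (a j)) :
    LittleDiscs n k :=
  ⟨fun i => (a i, r i),
    fun i => ⟨hpos i, closedBall_subset_closedBall' (by simpa using hone i)⟩,
    fun i j hij => ball_disjoint_ball (hsep i j hij)⟩

lemma perm_val_apply (e : Equiv.Perm (Fin k)) (d : LittleDiscs n k) (i : Fin k) :
    (perm e d).1 i = d.1 (e i) := rfl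

lemma radius_pos (d : LittleDiscs n k) (i : Fin k) : 0 < (d.1 i).2 := (d.2.1 i).1

lemma radius_add_norm_le_one (hn : 1 ≤ n) (d : LittleDiscs n k) (i : Fin k) :
    (d.1 i).2 + ‖(d.1 i).1‖ ≤ 1 := by
  have : Nonempty (Fin n) := ⟨⟨0, hn⟩⟩
  exact add_norm_le_one_of_closedBall_subset (d.radius_pos i).le (d.2.1 i).2

lemma radius_add_radius_le (d : LittleDiscs n k) {i j : Fin k} (hij : i ≠ j) :
    (d.1 i).2 + (d.1 j).2 ≤ dist (d.1 i).1 (d.1 j).1 :=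
  (disjoint_ball_ball_iff (d.radius_pos i) (d.radius_pos j)).mp (d.2.2 hij)

end LittleDiscs

namespace OrdConfig

variable {n k : ℕ}

/-- The points of a configuration in the unit ball, as vectors. -/
def points (p : OrdConfig (UnitBall n) k) (i : Fin k) : EuclideanSpace ℝ (Fin n) := (p.1 i).1

lemma points_injective (p : OrdConfig (UnitBall n) k) : Function.Injective p.points :=
  Subtype.val_injective.comp p.2

@[fun_prop]
lemma continuous_points : Continuous (points : OrdConfig (UnitBall n) k → _) :=
  continuous_pi fun i =>
    continuous_subtype_val.comp ((continuous_apply i).comp continuous_subtype_val)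

lemma clearance_points_pos (p : OrdConfig (UnitBall n) k) (i : Fin k) :
    0 < clearance p.points i :=
  clearance_pos p.points_injective (mem_ball_zero_iff.mp (p.1 i).2)

/-- Thicken each point of a configuration to the disc whose radius is the clearance there. -/
def thicken (n k : ℕ) : C(OrdConfig (UnitBall n) k, LittleDiscs n k) where
  toFun p := LittleDiscs.ofRadii p.points (clearance p.points) p.clearance_points_pos
    (clearance_add_norm_le_one _) fun _ _ => clearance_add_clearance_le _
  continuous_toFun := by
    refine Continuous.subtype_mk (continuous_pi fun i => ?_) _
    fun_prop

lemma points_perm (e : Equiv.Perm (Fin k)) (p : OrdConfig (UnitBall n) k) :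
    (perm e p).points = p.points ∘ e := rfl

lemma thicken_val_apply (p : OrdConfig (UnitBall n) k) (i : Fin k) :
    (thicken n k p).1 i = (p.points i, clearance p.points i) := rfl

lemma thicken_perm (e : Equiv.Perm (Fin k)) (p : OrdConfig (UnitBall n) k) :
    thicken n k (perm e p) = LittleDiscs.perm e (thicken n k p) := by
  refine Subtype.ext (funext fun i => ?_)
  rw [LittleDiscs.perm_val_apply, thicken_val_apply, thicken_val_apply, points_perm,
    clearance_comp_perm, Function.comp_apply]

lemma centerMap_comp_thicken : (centerMap n k).comp (thicken n k) = ContinuousMap.id _ := rfl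

end OrdConfig

namespace LittleDiscs

variable {n k : ℕ}

/-- Fix the centers and interpolate the radii linearly, from the clearances to the given ones. -/
def interpolateRadii (hn : 1 ≤ n) (t : I) (d : LittleDiscs n k) : LittleDiscs n k :=
  let p := centerMap n k d
  ofRadii p.points (fun i => AffineMap.lineMap (clearance p.points i) (d.1 i).2 (t : ℝ))
    (fun i => (convex_Ioi (0 : ℝ)).lineMap_mem (p.clearance_points_pos i) (d.radius_pos i) t.2)
    (fun i => by
      have h₁ := clearance_add_norm_le_one p.points i
      have h₂ : (d.1 i).2 + ‖p.points i‖ ≤ 1 := d.radius_add_norm_le_one hn i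
      rw [← le_sub_iff_add_le, ← mem_Iic] at *
      exact (convex_Iic _).lineMap_mem h₁ h₂ t.2)
    (fun i j hij => by
      have h₁ := clearance_add_clearance_le p.points hij
      have h₂ : (d.1 i).2 + (d.1 j).2 ≤ dist (p.points i) (p.points j) :=
        d.radius_add_radius_le hij
      rw [← mem_Iic] at h₁ h₂
      have h := (convex_Iic _).lineMap_mem h₁ h₂ t.2
      simp only [AffineMap.lineMap_apply_ring', mem_Iic] at h ⊢
      linarith)

lemma interpolateRadii_val_apply (hn : 1 ≤ n) (t : I) (d : LittleDiscs n k) (i : Fin k) :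
    (interpolateRadii hn t d).1 i = ((d.1 i).1,
      AffineMap.lineMap (clearance (centerMap n k d).points i) (d.1 i).2 (t : ℝ)) := rfl

lemma points_centerMap_perm (e : Equiv.Perm (Fin k)) (d : LittleDiscs n k) :
    (centerMap n k (perm e d)).points = (centerMap n k d).points ∘ e := rfl

lemma interpolateRadii_perm (hn : 1 ≤ n) (t : I) (e : Equiv.Perm (Fin k)) (d : LittleDiscs n k) :
    interpolateRadii hn t (perm e d) = perm e (interpolateRadii hn t d) := by
  refine Subtype.ext (funext fun i => ?_)
  rw [perm_val_apply, interpolateRadii_val_apply, interpolateRadii_val_apply, perm_val_apply,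
    points_centerMap_perm, clearance_comp_perm]

/-- The homotopy from thickening the centers to the identity that interpolates the radii. -/
def radiusHomotopy (hn : 1 ≤ n) (k : ℕ) :
    ((OrdConfig.thicken n k).comp (centerMap n k)).Homotopy (ContinuousMap.id _) where
  toFun x := interpolateRadii hn x.1 x.2
  continuous_toFun := by
    refine Continuous.subtype_mk (continuous_pi fun i => ?_) _
    have hdisc : Continuous fun x : I × LittleDiscs n k => x.2.1 i :=
      (continuous_apply i).comp (continuous_subtype_val.comp continuous_snd)
    have hclear : Continuous fun x : I × LittleDiscs n k =>
        clearance (centerMap n k x.2).points i :=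
      (continuous_clearance i).comp
        (OrdConfig.continuous_points.comp ((centerMap n k).continuous.comp continuous_snd))
    have htime : Continuous fun x : I × LittleDiscs n k => (x.1 : ℝ) :=
      continuous_subtype_val.comp continuous_fst
    simp only [AffineMap.lineMap_apply_ring']
    exact hdisc.fst.prodMk ((htime.mul (hdisc.snd.sub hclear)).add hclear)
  map_zero_left d := Subtype.ext <| funext fun i => Prod.ext rfl <|
    AffineMap.lineMap_apply_zero _ _
  map_one_left d := Subtype.ext <| funext fun i => Prod.ext rfl <|
    AffineMap.lineMap_apply_one _ _

end LittleDiscs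

/-- For every `n ≥ 1` and `k ≥ 0`, the center map
`D_n(k) → C⁰_k(B(0,1))` is a `Σ_k`-equivariant homotopy equivalence: there are a
`Σ_k`-equivariant homotopy inverse `g` and `Σ_k`-equivariant homotopies from
`g ∘ centerMap` and `centerMap ∘ g` to the respective identities. -/
theorem littleDiscs_centerMap_equivariant_homotopyEquiv (n k : ℕ) (hn : 1 ≤ n) :
    ∃ g : C(OrdConfig (UnitBall n) k, LittleDiscs n k),
      (∀ (e : Equiv.Perm (Fin k)) (p : OrdConfig (UnitBall n) k),
        g (OrdConfig.perm e p) = LittleDiscs.perm e (g p)) ∧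
      (∃ H : (g.comp (centerMap n k)).Homotopy (ContinuousMap.id _),
        ∀ (t : I) (e : Equiv.Perm (Fin k)) (d : LittleDiscs n k),
          H (t, LittleDiscs.perm e d) = LittleDiscs.perm e (H (t, d))) ∧
      (∃ H : ((centerMap n k).comp g).Homotopy (ContinuousMap.id _),
        ∀ (t : I) (e : Equiv.Perm (Fin k)) (p : OrdConfig (UnitBall n) k),
          H (t, OrdConfig.perm e p) = OrdConfig.perm e (H (t, p))) := by
  refine ⟨OrdConfig.thicken n k, OrdConfig.thicken_perm,
    ⟨LittleDiscs.radiusHomotopy hn k, LittleDiscs.interpolateRadii_perm hn⟩, ?_⟩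
  rw [OrdConfig.centerMap_comp_thicken]
  exact ⟨ContinuousMap.Homotopy.refl _, fun _ _ _ => rfl⟩

end
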